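/- Let N ≥ 4 be an integer and let p₁, …, p_m be distinct partitions of [k], each having at least one crossing, with cr(p_i) = cr(p_j) for all 1 ≤ i, j ≤ m. Let α ∈ ℂ^m be such that ξ = ∑_{i=1}^m α_i ξ_{p_i} is nonzero. Then ⟨NC, ξ⟩ = P (equality of families meaning equality of each subspace C(k',ℓ')). -/

import Mathlib

open scoped Classical

/-- The block relation of a finite partition of `Fin n` (partition of `[n]`):
`x ∼_p y` iff `x` and `y` lie in the same block of `p`. -/
def PartRel {n : ℕ} (p : Finpartition (Finset.univ : Finset (Fin n))) (x y : Fin n) : Prop :=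
  ∃ B ∈ p.parts, x ∈ B ∧ y ∈ B

/-- `κ` is a crossing of the relation `r`: `κ = {a,b,c,d}` with `a < b < c < d`,
`r a c`, `r b d`, and `¬ r a b`. -/
def IsCross {n : ℕ} (r : Fin n → Fin n → Prop) (κ : Finset (Fin n)) : Prop :=
  ∃ a b c d : Fin n, a < b ∧ b < c ∧ c < d ∧ κ = {a, b, c, d} ∧ r a c ∧ r b d ∧ ¬ r a b

/-- `cr p`: the set of crossings of the partition `p`. -/
def cr {n : ℕ} (p : Finpartition (Finset.univ : Finset (Fin n))) : Set (Finset (Fin n)) :=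
  {κ | IsCross (PartRel p) κ}


/-- `crossers p` (`χ(p)`): the union of all crossings of `p`. -/
def crossers {n : ℕ} (p : Finpartition (Finset.univ : Finset (Fin n))) : Set (Fin n) :=
  {x | ∃ κ ∈ cr p, x ∈ κ}

/-- The vector `ξ_p ∈ (ℂ^N)^{⊗k}`, identified with `(Fin k → Fin N) → ℂ`:
its coordinate at `i` is `1` if `i` is constant on every block of `p`, else `0`. -/
noncomputable def xi (N : ℕ) {k : ℕ} (p : Finpartition (Finset.univ : Finset (Fin k))) :
    (Fin k → Fin N) → ℂ :=
  fun i => if ∀ x y, PartRel p x y → i x = i y then 1 else 0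

/-- The span of the noncrossing-partition vectors `ξ_p`, `p ∈ NC(k)`. -/
noncomputable def ncSpan (N k : ℕ) : Submodule ℂ ((Fin k → Fin N) → ℂ) :=
  Submodule.span ℂ
    {v | ∃ p : Finpartition (Finset.univ : Finset (Fin k)), cr p = ∅ ∧ v = xi N p}

/-- The span of the crossing-partition vectors `ξ_p`, `p ∈ CR(k)`. -/
noncomputable def crSpan (N k : ℕ) : Submodule ℂ ((Fin k → Fin N) → ℂ) :=
  Submodule.span ℂ
    {v | ∃ p : Finpartition (Finset.univ : Finset (Fin k)), (cr p).Nonempty ∧ v = xi N p}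

/-- The span of all partition vectors `ξ_p`, `p ∈ P(k)`. -/
noncomputable def allSpan (N k : ℕ) : Submodule ℂ ((Fin k → Fin N) → ℂ) :=
  Submodule.span ℂ
    {v | ∃ p : Finpartition (Finset.univ : Finset (Fin k)), v = xi N p}

/-- Linear maps `(ℂ^N)^{⊗k} → (ℂ^N)^{⊗ℓ}`, as matrices with rows indexed by
lower index tuples and columns by upper index tuples. -/
abbrev Mat (N k ℓ : ℕ) := Matrix (Fin ℓ → Fin N) (Fin k → Fin N) ℂ

/-- The tensor product of two such linear maps. -/
def tensorMat {N k ℓ k' ℓ' : ℕ} (S : Mat N k ℓ) (T : Mat N k' ℓ') :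
    Mat N (k + k') (ℓ + ℓ') :=
  fun i j =>
    S (fun a => i (Fin.castAdd ℓ' a)) (fun b => j (Fin.castAdd k' b)) *
      T (fun a => i (Fin.natAdd ℓ a)) (fun b => j (Fin.natAdd k b))

/-- The cup: the map `(ℂ^N)^{⊗2} → ℂ` sending `e_i ⊗ e_j` to `δ_{ij}`. -/
def cupMat (N : ℕ) : Mat N 2 0 := fun _ j => if j 0 = j 1 then 1 else 0

/-- A Tannaka–Krein dual at parameter `N`: a family of subspaces
`C k ℓ ⊆ Hom((ℂ^N)^{⊗k}, (ℂ^N)^{⊗ℓ})` closed under tensor products, composition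
and adjoints, containing the identity of `ℂ^N` and the cup. -/
structure TKDual (N : ℕ) where
  C : ∀ k ℓ : ℕ, Submodule ℂ (Mat N k ℓ)
  tensor_mem : ∀ {k ℓ k' ℓ' : ℕ} {S : Mat N k ℓ} {T : Mat N k' ℓ'},
    S ∈ C k ℓ → T ∈ C k' ℓ' → tensorMat S T ∈ C (k + k') (ℓ + ℓ')
  comp_mem : ∀ {k ℓ r : ℕ} {S : Mat N ℓ r} {T : Mat N k ℓ},
    S ∈ C ℓ r → T ∈ C k ℓ → S * T ∈ C k r
  adj_mem : ∀ {k ℓ : ℕ} {T : Mat N k ℓ}, T ∈ C k ℓ → T.conjTranspose ∈ C ℓ k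
  id_mem : (1 : Matrix (Fin 1 → Fin N) (Fin 1 → Fin N) ℂ) ∈ C 1 1
  cup_mem : cupMat N ∈ C 2 0

/-- The involution of `Fin (k + ℓ)` fixing the first `k` (upper) points and
reversing the order of the last `ℓ` (lower) points. -/
def lowerRev (k ℓ : ℕ) : Fin (k + ℓ) → Fin (k + ℓ) :=
  Fin.append (fun a : Fin k => Fin.castAdd ℓ a) (fun a : Fin ℓ => Fin.natAdd k a.rev)

/-- A partition of `[k + ℓ]` (first `k` points upper, last `ℓ` points lower) is
noncrossing when the partition obtained by reversing the order of the lower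
points has no crossing. -/
def IsNCPart {k ℓ : ℕ} (p : Finpartition (Finset.univ : Finset (Fin (k + ℓ)))) : Prop :=
  ∀ κ, ¬ IsCross (fun x y => PartRel p (lowerRev k ℓ x) (lowerRev k ℓ y)) κ

/-- The linear map `T_p : (ℂ^N)^{⊗k} → (ℂ^N)^{⊗ℓ}` of a partition `p` of `[k + ℓ]`:
its entry at (lower tuple `i`, upper tuple `j`) is `1` if the labelling of the points
of `p` by `j` on the upper points and `i` on the lower points is constant on each
block of `p`, and `0` otherwise. -/
noncomputable def Tmat (N : ℕ) (k ℓ : ℕ)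
    (p : Finpartition (Finset.univ : Finset (Fin (k + ℓ)))) : Mat N k ℓ :=
  fun i j => if ∀ x y, PartRel p x y → Fin.append j i x = Fin.append j i y then 1 else 0

/-- The family `P(k,ℓ) = span{T_p : p a partition of [k+ℓ]}`. -/
noncomputable def Pfam (N k ℓ : ℕ) : Submodule ℂ (Mat N k ℓ) :=
  Submodule.span ℂ (Set.range (Tmat N k ℓ))

/-- The family `NC(k,ℓ) = span{T_p : p a noncrossing partition of [k+ℓ]}`. -/
noncomputable def NCfam (N k ℓ : ℕ) : Submodule ℂ (Mat N k ℓ) :=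
  Submodule.span ℂ {T | ∃ p, IsNCPart p ∧ T = Tmat N k ℓ p}

/-- A vector in `(ℂ^N)^{⊗k}` viewed as a linear map `(ℂ^N)^{⊗0} → (ℂ^N)^{⊗k}`. -/
def vecMat {N k : ℕ} (v : (Fin k → Fin N) → ℂ) : Mat N 0 k := fun i _ => v i

/-- `⟨NC, ξ⟩`: the smallest Tannaka–Krein dual containing all of `NC` together with
the vector `ξ ∈ (ℂ^N)^{⊗k}` (in degree `(0,k)`), i.e. the intersection of all such. -/
noncomputable def genNCxi (N : ℕ) {k : ℕ} (ξ : (Fin k → Fin N) → ℂ) (k' ℓ' : ℕ) :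
    Submodule ℂ (Mat N k' ℓ') :=
  ⨅ (C : TKDual N) (_ : ∀ a b, NCfam N a b ≤ C.C a b) (_ : vecMat ξ ∈ C.C 0 k),
    C.C k' ℓ'

theorem exists_partRel {n : ℕ} (s : Setoid (Fin n)) :
    ∃ p : Finpartition (Finset.univ : Finset (Fin n)), ∀ x y, PartRel p x y ↔ s x y := by
  refine ⟨Finpartition.ofSetoid s, fun x y => ?_⟩
  rw [← Finpartition.mem_part_ofSetoid_iff_rel]
  constructor
  · rintro ⟨B, hB, hx, hy⟩
    rwa [Finpartition.part_eq_of_mem _ hB hx]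
  · intro h
    exact ⟨_, (Finpartition.part_mem _).2 (Finset.mem_univ x),
      Finpartition.mem_part _ (Finset.mem_univ x), h⟩

/-- The block relation of a partition, as a setoid. -/
def partSetoid {n : ℕ} (p : Finpartition (Finset.univ : Finset (Fin n))) : Setoid (Fin n) where
  r := PartRel p
  iseqv :=
    { refl := fun x => ⟨_, (Finpartition.part_mem _).2 (Finset.mem_univ x),
        Finpartition.mem_part _ (Finset.mem_univ x), Finpartition.mem_part _ (Finset.mem_univ x)⟩
      symm := fun ⟨B, hB, hx, hy⟩ => ⟨B, hB, hy, hx⟩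
      trans := fun ⟨B, hB, hx, hy⟩ ⟨_, hB', hy', hz⟩ =>
        ⟨B, hB, hx, p.eq_of_mem_parts hB hB' hy hy' ▸ hz⟩ }

/-- The vector attached to a setoid: the indicator function of the tuples that are constant on
its classes. -/
noncomputable def relVec (N : ℕ) {n : ℕ} (s : Setoid (Fin n)) : (Fin n → Fin N) → ℂ :=
  fun i => if ∀ x y, s x y → i x = i y then 1 else 0

theorem xi_eq_relVec (N : ℕ) {n : ℕ} (p : Finpartition (Finset.univ : Finset (Fin n))) :
    xi N p = relVec N (partSetoid p) := rfl

/-! ### Families of invariant maps -/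

/-- The maps which commute with the action of the symmetric group. -/
def invariantSubmodule (N k ℓ : ℕ) : Submodule ℂ (Mat N k ℓ) where
  carrier := {T | ∀ (σ : Equiv.Perm (Fin N)) i j, T (σ ∘ i) (σ ∘ j) = T i j}
  add_mem' := fun hS hT σ i j => by
    rw [Matrix.add_apply, Matrix.add_apply, hS, hT]
  zero_mem' := fun σ i j => rfl
  smul_mem' := fun c T hT σ i j => by
    rw [Matrix.smul_apply, Matrix.smul_apply, hT]

/-- The Tannaka–Krein dual of all maps commuting with the symmetric group. -/
def invariantDual (N : ℕ) : TKDual N where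
  C := invariantSubmodule N
  tensor_mem := fun hS hT σ i j => by
    exact congrArg₂ (· * ·) (hS σ _ _) (hT σ _ _)
  comp_mem := by
    intro k ℓ r S T hS hT σ i j
    rw [Matrix.mul_apply, Matrix.mul_apply,
      ← Equiv.sum_comp (Equiv.arrowCongr (Equiv.refl (Fin ℓ)) σ)]
    refine Finset.sum_congr rfl fun u _ => ?_
    rw [← hS σ i u, ← hT σ u j]
    rfl
  adj_mem := fun hT σ i j => by
    rw [Matrix.conjTranspose_apply, Matrix.conjTranspose_apply, hT]
  id_mem := fun σ i j => by
    simp only [Matrix.one_apply, σ.injective.comp_left.eq_iff]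
  cup_mem := fun σ i j => by
    simp [cupMat]

theorem Tmat_mem_invariantSubmodule (N k ℓ : ℕ)
    (p : Finpartition (Finset.univ : Finset (Fin (k + ℓ)))) :
    Tmat N k ℓ p ∈ invariantSubmodule N k ℓ := by
  intro σ i j
  have h : Fin.append (σ ∘ j) (σ ∘ i) = σ ∘ Fin.append j i := by
    funext x
    refine Fin.addCases (fun a => ?_) (fun a => ?_) x <;> simp
  simp only [Tmat, h, Function.comp_apply, σ.injective.eq_iff]

theorem relVec_comp_perm {N n : ℕ} (s : Setoid (Fin n)) (σ : Equiv.Perm (Fin N))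
    (i : Fin n → Fin N) : relVec N s (σ ∘ i) = relVec N s i := by
  simp only [relVec, Function.comp_apply, σ.injective.eq_iff]

theorem exists_perm_comp_eq {ι β : Type*} [Fintype β] {f g : ι → β}
    (h : ∀ x y, f x = f y ↔ g x = g y) : ∃ σ : Equiv.Perm β, σ ∘ f = g := by
  have hk : Setoid.ker f = Setoid.ker g := Setoid.ext h
  let e : {b // b ∈ Set.range f} ≃ {b // b ∈ Set.range g} :=
    (Setoid.quotientKerEquivRange f).symm.trans
      ((Quotient.congrRight fun x y => h x y).trans (Setoid.quotientKerEquivRange g))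
  refine ⟨e.extendSubtype, funext fun x => ?_⟩
  rw [Function.comp_apply, Equiv.extendSubtype_apply_of_mem e (f x) ⟨x, rfl⟩]
  have h1 : (Setoid.quotientKerEquivRange f).symm ⟨f x, x, rfl⟩ = Quotient.mk _ x := by
    rw [Equiv.symm_apply_eq]; rfl
  simp only [e, Equiv.trans_apply, h1]
  rfl

theorem finite_setoid (ι : Type*) [Finite ι] : Finite (Setoid ι) :=
  Finite.of_injective (fun s : Setoid ι => fun x y => s x y)
    fun _ _ h => Setoid.ext fun x y => iff_of_eq (congrFun (congrFun h x) y)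

/-- The indicator function of the tuples whose kernel is a given setoid is a linear combination of
the vectors attached to setoids. -/
theorem kerIndicator_mem_span (N n : ℕ) (s : Setoid (Fin n)) :
    (fun i : Fin n → Fin N => if Setoid.ker i = s then (1 : ℂ) else 0) ∈
      Submodule.span ℂ (Set.range (relVec N (n := n))) := by
  have := finite_setoid (Fin n)
  have := Fintype.ofFinite (Setoid (Fin n))
  induction s using WellFoundedGT.induction with
  | ind s ih =>
    have key : (fun i : Fin n → Fin N => if Setoid.ker i = s then (1 : ℂ) else 0) =
        relVec N s - ∑ t with s < t, fun i => if Setoid.ker i = t then (1 : ℂ) else 0 := by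
      funext i
      have hle : (∀ x y, s x y → i x = i y) ↔ s ≤ Setoid.ker i := by
        rw [Setoid.le_def]; rfl
      simp only [Pi.sub_apply, Finset.sum_apply, Finset.sum_ite_eq, relVec, hle,
        Finset.mem_filter, Finset.mem_univ, true_and]
      by_cases h1 : Setoid.ker i = s
      · simp [h1]
      · by_cases h2 : s ≤ Setoid.ker i
        · simp [h1, h2, lt_of_le_of_ne h2 (Ne.symm h1)]
        · simpa [h1, h2] using fun h : s < Setoid.ker i => h2 h.le
    rw [key]
    exact Submodule.sub_mem _ (Submodule.subset_span ⟨s, rfl⟩)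
      (Submodule.sum_mem _ fun t ht => ih t (Finset.mem_filter.1 ht).2)

theorem mem_span_relVec {N n : ℕ} (f : (Fin n → Fin N) → ℂ)
    (hf : ∀ (σ : Equiv.Perm (Fin N)) i, f (σ ∘ i) = f i) :
    f ∈ Submodule.span ℂ (Set.range (relVec N (n := n))) := by
  have := finite_setoid (Fin n)
  have := Fintype.ofFinite (Setoid (Fin n))
  let c : Setoid (Fin n) → ℂ := fun s =>
    if h : ∃ i : Fin n → Fin N, Setoid.ker i = s then f h.choose else 0
  have key : f = ∑ s, c s • fun i => if Setoid.ker i = s then (1 : ℂ) else 0 := by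
    funext i
    have hex : ∃ j : Fin n → Fin N, Setoid.ker j = Setoid.ker i := ⟨i, rfl⟩
    simp only [Finset.sum_apply, Pi.smul_apply, smul_eq_mul, mul_ite, mul_one, mul_zero,
      Finset.sum_ite_eq, Finset.mem_univ, if_true]
    simp only [c, dif_pos hex]
    obtain ⟨σ, hσ⟩ := exists_perm_comp_eq (f := i) (g := hex.choose)
      fun x y => (iff_of_eq (congrArg (fun t : Setoid (Fin n) => t x y) hex.choose_spec)).symm
    rw [← hσ, hf]
  rw [key]
  exact Submodule.sum_mem _ fun s _ => Submodule.smul_mem _ _ (kerIndicator_mem_span N n s)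

theorem invariantSubmodule_le_Pfam (N k ℓ : ℕ) :
    invariantSubmodule N k ℓ ≤ Pfam N k ℓ := by
  intro T hT
  let Φ : ((Fin (k + ℓ) → Fin N) → ℂ) →ₗ[ℂ] Mat N k ℓ :=
    { toFun := fun f i j => f (Fin.append j i)
      map_add' := fun _ _ => rfl
      map_smul' := fun _ _ => rfl }
  have hΦ : T = Φ fun u => T (fun a => u (Fin.natAdd k a)) (fun a => u (Fin.castAdd ℓ a)) := by
    ext i j
    change T i j = T _ _
    congr 1 <;> funext a <;> simp
  have hspan : Submodule.span ℂ (Set.range (relVec N (n := k + ℓ))) ≤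
      (Pfam N k ℓ).comap Φ := by
    refine Submodule.span_le.2 ?_
    rintro _ ⟨s, rfl⟩
    obtain ⟨p, hp⟩ := exists_partRel s
    refine Submodule.subset_span ⟨p, ?_⟩
    funext i j
    simp only [Tmat, hp]
    rfl
  rw [hΦ]
  exact hspan (mem_span_relVec _ fun σ u => hT σ _ _)

theorem NCfam_le_invariantSubmodule (N k ℓ : ℕ) :
    NCfam N k ℓ ≤ invariantSubmodule N k ℓ := by
  refine Submodule.span_le.2 ?_
  rintro _ ⟨p, -, rfl⟩
  exact Tmat_mem_invariantSubmodule N k ℓ p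

/-! ### Noncrossing labellings -/

/-- The matrix attached to a labelling of the upper and lower points, whose fibres are the blocks
of the corresponding partition. -/
noncomputable def labelMat (N : ℕ) {β : Type*} {k ℓ : ℕ} (f : Fin k → β) (g : Fin ℓ → β) :
    Mat N k ℓ :=
  fun i j => if (∀ x y, f x = f y → j x = j y) ∧ (∀ x y, f x = g y → j x = i y) ∧
    ∀ x y, g x = g y → i x = i y then 1 else 0

theorem lowerRev_castAdd {k ℓ : ℕ} (a : Fin k) :
    lowerRev k ℓ (Fin.castAdd ℓ a) = Fin.castAdd ℓ a := by
  simp [lowerRev]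

theorem lowerRev_natAdd {k ℓ : ℕ} (a : Fin ℓ) :
    lowerRev k ℓ (Fin.natAdd k a) = Fin.natAdd k a.rev := by
  simp [lowerRev]

theorem Tmat_eq_labelMat (N : ℕ) {β : Type*} {k ℓ : ℕ}
    {p : Finpartition (Finset.univ : Finset (Fin (k + ℓ)))} {lab : Fin (k + ℓ) → β}
    (hp : ∀ x y, PartRel p x y ↔ lab x = lab y) :
    Tmat N k ℓ p =
      labelMat N (fun x => lab (Fin.castAdd ℓ x)) (fun x => lab (Fin.natAdd k x)) := by
  funext i j
  simp only [labelMat, Tmat, hp]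
  congr 1
  refine propext ⟨fun H => ⟨fun x y => ?_, fun x y => ?_, fun x y => ?_⟩,
    fun ⟨h1, h2, h3⟩ x y => ?_⟩
  · simpa using H (Fin.castAdd ℓ x) (Fin.castAdd ℓ y)
  · simpa using H (Fin.castAdd ℓ x) (Fin.natAdd k y)
  · simpa using H (Fin.natAdd k x) (Fin.natAdd k y)
  · refine Fin.addCases (fun a => ?_) (fun a => ?_) x <;>
      refine Fin.addCases (fun b => ?_) (fun b => ?_) y
    · simpa using h1 a b
    · simpa using h2 a b
    · simpa [eq_comm] using h2 b a
    · simpa using h3 a b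

theorem labelMat_mem_NCfam (N : ℕ) {β : Type*} {k ℓ : ℕ} (f : Fin k → β) (g : Fin ℓ → β)
    (h : ∀ u₁ u₂ u₃ u₄ : Fin (k + ℓ), u₁ < u₂ → u₂ < u₃ → u₃ < u₄ →
      Fin.append f (g ∘ Fin.rev) u₁ = Fin.append f (g ∘ Fin.rev) u₃ →
      Fin.append f (g ∘ Fin.rev) u₂ = Fin.append f (g ∘ Fin.rev) u₄ →
      Fin.append f (g ∘ Fin.rev) u₁ = Fin.append f (g ∘ Fin.rev) u₂) :
    labelMat N f g ∈ NCfam N k ℓ := by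
  obtain ⟨p, hp⟩ := exists_partRel (Setoid.ker (Fin.append f g))
  replace hp : ∀ x y, PartRel p x y ↔ Fin.append f g x = Fin.append f g y := hp
  have hrev : ∀ u, Fin.append f g (lowerRev k ℓ u) = Fin.append f (g ∘ Fin.rev) u := by
    intro u
    refine Fin.addCases (fun a => ?_) (fun a => ?_) u
    · simp [lowerRev_castAdd]
    · simp [lowerRev_natAdd]
  refine Submodule.subset_span ⟨p, ?_, ?_⟩
  · rintro κ ⟨a, b, c, d, hab, hbc, hcd, -, h1, h2, h3⟩
    simp only [hp, hrev] at h1 h2 h3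
    exact h3 (h a b c d hab hbc hcd h1 h2)
  · rw [Tmat_eq_labelMat N hp]
    simp only [Fin.append_left, Fin.append_right]

theorem labelMat_mem_NCfam_of_monotone (N : ℕ) {β : Type*} [LinearOrder β] {k ℓ : ℕ}
    {f : Fin k → β} {g : Fin ℓ → β} (hf : Monotone f) (hg : Monotone g) :
    labelMat N f g ∈ NCfam N k ℓ := by
  refine labelMat_mem_NCfam N f g fun u₁ u₂ u₃ u₄ h12 h23 h34 h13 h24 => ?_
  have noValley : ∀ x y z : Fin (k + ℓ), x < y → y < z →
      Fin.append f (g ∘ Fin.rev) y < Fin.append f (g ∘ Fin.rev) x →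
      Fin.append f (g ∘ Fin.rev) z ≤ Fin.append f (g ∘ Fin.rev) y := by
    intro x y z
    refine Fin.addCases (fun a => ?_) (fun a => ?_) x <;>
      refine Fin.addCases (fun b => ?_) (fun b => ?_) y <;>
      refine Fin.addCases (fun c => ?_) (fun c => ?_) z <;>
      intro hxy hyz <;>
      simp only [Fin.append_left, Fin.append_right, Function.comp_apply] <;>
      intro hlt
    any_goals exact absurd (hf (show a ≤ b from hxy.le)) (not_le.2 hlt)
    all_goals first
      | exact hg (by
          simp only [Fin.lt_def, Fin.val_natAdd] at hyz
          rw [Fin.rev_le_rev, Fin.le_def]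
          omega)
      | (exfalso; simp only [Fin.lt_def, Fin.val_natAdd, Fin.val_castAdd] at hxy hyz; omega)
  rcases lt_trichotomy (Fin.append f (g ∘ Fin.rev) u₁) (Fin.append f (g ∘ Fin.rev) u₂)
    with h | h | h
  · have := noValley u₂ u₃ u₄ h23 h34 (h13 ▸ h)
    rw [← h24, ← h13] at this
    exact absurd h (not_lt.2 this)
  · exact h
  · have := noValley u₁ u₂ u₃ h12 h23 h
    rw [← h13] at this
    exact absurd h (not_lt.2 this)

theorem labelMat_comp_perm (N : ℕ) {β : Type*} {k ℓ : ℕ} (f : Fin k → β) (g : Fin ℓ → β)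
    (σ : Equiv.Perm (Fin k)) (τ : Equiv.Perm (Fin ℓ)) (i : Fin ℓ → Fin N) (j : Fin k → Fin N) :
    labelMat N (f ∘ σ) (g ∘ τ) (i ∘ τ) (j ∘ σ) = labelMat N f g i j := by
  simp only [labelMat, Function.comp_apply]
  congr 1
  exact propext (and_congr (σ.forall_congr fun _ => σ.forall_congr fun _ => Iff.rfl)
    (and_congr (σ.forall_congr fun _ => τ.forall_congr fun _ => Iff.rfl)
      (τ.forall_congr fun _ => τ.forall_congr fun _ => Iff.rfl)))

theorem labelMat_of_injective (N : ℕ) {β : Type*} {n : ℕ} {f : Fin n → β}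
    (hf : Function.Injective f) : labelMat N f f = 1 := by
  funext i j
  simp only [labelMat, Matrix.one_apply]
  congr 1
  refine propext ⟨fun h => funext fun x => (h.2.1 x x rfl).symm, ?_⟩
  rintro rfl
  exact ⟨fun x y h => by rw [hf h], fun x y h => by rw [hf h], fun x y h => by rw [hf h]⟩

/-! ### Operations in a Tannaka–Krein dual -/

namespace TKDual

variable {N : ℕ} (C : TKDual N)

theorem one_mem (hC : ∀ a b, NCfam N a b ≤ C.C a b) (n : ℕ) : (1 : Mat N n n) ∈ C.C n n := by
  rw [← labelMat_of_injective N (f := (id : Fin n → Fin n)) Function.injective_id]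
  exact hC _ _ (labelMat_mem_NCfam_of_monotone N monotone_id monotone_id)

theorem cast_mem {k k' ℓ ℓ' : ℕ} (hk : k = k') (hℓ : ℓ = ℓ') {T : Mat N k ℓ} (hT : T ∈ C.C k ℓ) :
    T.submatrix (fun i => i ∘ Fin.cast hℓ) (fun j => j ∘ Fin.cast hk) ∈ C.C k' ℓ' := by
  subst hk hℓ
  exact hT

/-- Contracting the first two of `ℓ + 2` legs. -/
theorem contract_mem (hC : ∀ a b, NCfam N a b ≤ C.C a b) (ℓ : ℕ) :
    (Matrix.of fun i u => if u (Fin.castAdd (ℓ + 1) 0) = u (Fin.natAdd 1 0) ∧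
      i = fun a => u (Fin.natAdd 1 (Fin.succ a)) then 1 else 0 : Mat N (1 + (ℓ + 1)) ℓ) ∈
      C.C (1 + (ℓ + 1)) ℓ := by
  convert C.cast_mem (show 2 + ℓ = 1 + (ℓ + 1) by omega) (zero_add ℓ)
    (C.tensor_mem C.cup_mem (C.one_mem hC ℓ)) using 1
  ext i u
  have e1 : ∀ a : Fin ℓ, Fin.cast (show 2 + ℓ = 1 + (ℓ + 1) by omega) (Fin.natAdd 2 a) =
      Fin.natAdd 1 (Fin.succ a) := fun a => Fin.ext (by simp; omega)
  have e2 : ∀ a : Fin ℓ, Fin.cast (zero_add ℓ) (Fin.natAdd 0 a) = a := fun a => Fin.ext (by simp)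
  have e3 : Fin.cast (show 2 + ℓ = 1 + (ℓ + 1) by omega) (Fin.castAdd ℓ 0) =
      Fin.castAdd (ℓ + 1) 0 := Fin.ext (by simp)
  have e4 : Fin.cast (show 2 + ℓ = 1 + (ℓ + 1) by omega) (Fin.castAdd ℓ 1) =
      Fin.natAdd 1 0 := Fin.ext (by simp)
  simp only [Matrix.of_apply, Matrix.submatrix_apply, tensorMat, cupMat, Matrix.one_apply,
    Function.comp_apply, e1, e2, e3, e4, ite_and, ite_mul, one_mul, zero_mul]

/-- Bending the first lower leg to the first upper position. -/
theorem bend_mem (hC : ∀ a b, NCfam N a b ≤ C.C a b) {k ℓ : ℕ} {T : Mat N k (ℓ + 1)}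
    (hT : T ∈ C.C k (ℓ + 1)) :
    (Matrix.of fun i j => T (Fin.cons (j 0) i) (Fin.tail j) : Mat N (k + 1) ℓ) ∈
      C.C (k + 1) ℓ := by
  convert C.cast_mem (add_comm 1 k) rfl
    (C.comp_mem (C.contract_mem hC ℓ) (C.tensor_mem C.id_mem hT)) using 1
  ext i j
  have e1 : Fin.cast (add_comm 1 k) (Fin.castAdd k 0) = 0 := Fin.ext (by simp)
  have e2 : (fun b => j (Fin.cast (add_comm 1 k) (Fin.natAdd 1 b))) = Fin.tail j :=
    funext fun b => congrArg j (Fin.ext (by simp))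
  rw [Matrix.submatrix_apply, Matrix.mul_apply, Finset.sum_eq_single
    (Fin.append (fun _ : Fin 1 => j 0) (Fin.cons (j 0) i : Fin (ℓ + 1) → Fin N))]
  · simp only [Matrix.of_apply, tensorMat, Matrix.one_apply, Function.comp_apply, e2,
      Fin.append_left, Fin.append_right, Fin.cons_zero, Fin.cons_succ]
    rw [if_pos ⟨trivial, rfl⟩, if_pos, one_mul, one_mul]
    funext b
    rw [Subsingleton.elim b 0, e1]
  · intro u _ hu
    simp only [Matrix.of_apply, tensorMat, Matrix.one_apply, Function.comp_apply]
    by_contra hne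
    obtain ⟨h1, h2⟩ := mul_ne_zero_iff.1 hne
    obtain ⟨h3, h4⟩ := of_not_not fun h => h1 (if_neg h)
    have h5 := of_not_not fun h => (mul_ne_zero_iff.1 h2).1 (if_neg h)
    have h6 := congrFun h5 0
    rw [e1] at h6
    refine hu (funext fun x => ?_)
    refine Fin.addCases (fun a => ?_) (fun a => ?_) x
    · rw [Fin.append_left, Subsingleton.elim a 0, h6]
    · rw [Fin.append_right]
      refine Fin.cases ?_ (fun a => ?_) a
      · rw [Fin.cons_zero, ← h3, h6]
      · rw [Fin.cons_succ]
        exact (congrFun h4 a).symm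
  · simp

/-- Rotating a vector. -/
theorem rotate_mem {k : ℕ} {v : (Fin (k + 1) → Fin N) → ℂ} (hC : ∀ a b, NCfam N a b ≤ C.C a b)
    (hv : vecMat v ∈ C.C 0 (k + 1)) :
    vecMat (fun i : Fin (k + 1) → Fin N => v (Fin.cons (i (Fin.last k)) (Fin.init i))) ∈
      C.C 0 (k + 1) := by
  convert C.comp_mem (C.tensor_mem (C.bend_mem hC hv) C.id_mem) (C.adj_mem C.cup_mem) using 1
  ext i j
  rw [Matrix.mul_apply, Finset.sum_eq_single (fun _ => i (Fin.last k))]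
  · have h : (fun a : Fin 1 => i (Fin.natAdd k a)) = fun _ => i (Fin.last k) :=
      funext fun a => by rw [Subsingleton.elim a 0]; rfl
    simp [vecMat, tensorMat, cupMat, Matrix.conjTranspose_apply, Matrix.one_apply, h]
    rfl
  · intro u _ hu
    by_contra hne
    obtain ⟨h1, h2⟩ := mul_ne_zero_iff.1 hne
    simp [vecMat, tensorMat, cupMat, Matrix.conjTranspose_apply, Matrix.one_apply] at h1 h2
    have h3 : i (Fin.last k) = u 1 := congrFun h1.1 0
    refine hu (funext fun x => ?_)
    match x with
    | 0 => rw [h3, h2]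
    | 1 => exact h3.symm
  · simp

/-- The matrix exchanging two tensor legs. -/
def swapMat (N : ℕ) : Mat N 2 2 :=
  Matrix.of fun i j => if i 0 = j 1 ∧ i 1 = j 0 then 1 else 0

theorem swapMat_mem (hC : ∀ a b, NCfam N a b ≤ C.C a b)
    (h : vecMat (fun y : Fin 4 → Fin N => if y 0 = y 2 ∧ y 1 = y 3 then 1 else 0) ∈ C.C 0 4) :
    swapMat N ∈ C.C 2 2 := by
  convert C.bend_mem hC (C.bend_mem hC h) using 1
  ext i j
  have e0 : (Fin.cons (Fin.tail j 0) (Fin.cons (j 0) i) : Fin 4 → Fin N) 0 = j 1 := rfl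
  have e1 : (Fin.cons (Fin.tail j 0) (Fin.cons (j 0) i) : Fin 4 → Fin N) 1 = j 0 := rfl
  have e2 : (Fin.cons (Fin.tail j 0) (Fin.cons (j 0) i) : Fin 4 → Fin N) 2 = i 0 := rfl
  have e3 : (Fin.cons (Fin.tail j 0) (Fin.cons (j 0) i) : Fin 4 → Fin N) 3 = i 1 := rfl
  simp only [swapMat, Matrix.of_apply, vecMat]
  erw [e0, e1, e2, e3]
  simp only [eq_comm]

/-- The matrix permuting the tensor legs. -/
def permMat (N : ℕ) {n : ℕ} (σ : Equiv.Perm (Fin n)) : Mat N n n :=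
  (1 : Mat N n n).submatrix id fun j => j ∘ σ

theorem mul_permMat {k n : ℕ} (T : Mat N n k) (σ : Equiv.Perm (Fin n)) :
    T * permMat N σ = T.submatrix id fun j => j ∘ σ :=
  Matrix.mul_submatrix_one (Equiv.refl (Fin n → Fin N)) (fun j => j ∘ σ) T

theorem permMat_inv_mul {k n : ℕ} (T : Mat N k n) (σ : Equiv.Perm (Fin n)) :
    permMat N σ⁻¹ * T = T.submatrix (fun i => i ∘ σ) id :=
  Matrix.one_submatrix_mul id (Equiv.arrowCongr σ (Equiv.refl (Fin N))) T

theorem permMat_mul (N : ℕ) {n : ℕ} (σ τ : Equiv.Perm (Fin n)) :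
    permMat N σ * permMat N τ = permMat N (τ * σ) :=
  mul_permMat _ _

theorem permMat_swap_mem (hC : ∀ a b, NCfam N a b ≤ C.C a b) (h : swapMat N ∈ C.C 2 2) {n : ℕ}
    (a : Fin n) : permMat N (Equiv.swap a.castSucc a.succ) ∈ C.C (n + 1) (n + 1) := by
  obtain ⟨b, hb⟩ : ∃ b, a.val + 2 + b = n + 1 := ⟨n - 1 - a.val, by omega⟩
  convert C.cast_mem hb hb (C.tensor_mem (C.tensor_mem (C.one_mem hC a.val) h) (C.one_mem hC b))
    using 1
  ext i j
  simp only [permMat, tensorMat, swapMat, Matrix.submatrix_apply, Matrix.one_apply, id,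
    Matrix.of_apply, ← ite_and, ite_mul, one_mul, zero_mul, Function.comp_apply]
  congr 1
  have e0 : Fin.cast hb (Fin.castAdd b (Fin.natAdd a.val 0)) = a.castSucc := Fin.ext (by simp)
  have e1 : Fin.cast hb (Fin.castAdd b (Fin.natAdd a.val 1)) = a.succ := Fin.ext (by simp)
  rw [e0, e1]
  refine propext ⟨?_, fun H => funext fun x => ?_⟩
  · rintro rfl
    refine ⟨⟨funext fun x => ?_, by simp, by simp⟩, funext fun x => ?_⟩ <;>
      rw [Function.comp_apply, Equiv.swap_apply_of_ne_of_ne] <;>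
      simp [Fin.ext_iff] <;> omega
  · obtain ⟨⟨h1, h2, h3⟩, h4⟩ := H
    rw [Function.comp_apply]
    by_cases hx : x = a.castSucc
    · rw [hx, Equiv.swap_apply_left, h2]
    by_cases hx' : x = a.succ
    · rw [hx', Equiv.swap_apply_right, h3]
    rw [Equiv.swap_apply_of_ne_of_ne hx hx']
    rw [Fin.ext_iff, Fin.val_castSucc] at hx
    rw [Fin.ext_iff, Fin.val_succ] at hx'
    by_cases hlt : x.val < a.val
    · exact congrFun h1 ⟨x.val, hlt⟩
    · have hx2 : x = Fin.cast hb (Fin.natAdd (a.val + 2) ⟨x.val - (a.val + 2), by omega⟩) :=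
        Fin.ext (by simp; omega)
      rw [hx2]
      exact congrFun h4 _

theorem permMat_mem (hC : ∀ a b, NCfam N a b ≤ C.C a b) (h : swapMat N ∈ C.C 2 2) {n : ℕ}
    (σ : Equiv.Perm (Fin n)) : permMat N σ ∈ C.C n n := by
  cases n with
  | zero =>
    rw [Subsingleton.elim σ 1]
    exact C.one_mem hC 0
  | succ n =>
    have hσ : σ ∈ Submonoid.closure
        (Set.range fun a : Fin n => Equiv.swap a.castSucc a.succ) := by
      rw [Equiv.Perm.mclosure_swap_castSucc_succ]
      trivial
    induction hσ using Submonoid.closure_induction with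
    | mem σ hσ =>
      obtain ⟨a, rfl⟩ := hσ
      exact C.permMat_swap_mem hC h a
    | one => exact C.one_mem hC (n + 1)
    | mul σ τ _ _ h1 h2 =>
      rw [← permMat_mul]
      exact C.comp_mem h2 h1

theorem Pfam_le (hC : ∀ a b, NCfam N a b ≤ C.C a b) (h : swapMat N ∈ C.C 2 2) (k ℓ : ℕ) :
    Pfam N k ℓ ≤ C.C k ℓ := by
  refine Submodule.span_le.2 ?_
  rintro _ ⟨p, rfl⟩
  let lab : Fin (k + ℓ) → Fin (k + ℓ) := fun x => (Quotient.mk (partSetoid p) x).out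
  have hlab : ∀ x y, PartRel p x y ↔ lab x = lab y := fun x y => by
    rw [Quotient.out_inj, Quotient.eq]
    rfl
  let f : Fin k → Fin (k + ℓ) := fun x => lab (Fin.castAdd ℓ x)
  let g : Fin ℓ → Fin (k + ℓ) := fun x => lab (Fin.natAdd k x)
  have key : Tmat N k ℓ p = permMat N (Tuple.sort g)⁻¹ *
      labelMat N (f ∘ Tuple.sort f) (g ∘ Tuple.sort g) * permMat N (Tuple.sort f) := by
    rw [permMat_inv_mul, mul_permMat]
    ext i j
    rw [Tmat_eq_labelMat N hlab, ← labelMat_comp_perm N f g (Tuple.sort f) (Tuple.sort g)]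
    rfl
  rw [key]
  exact C.comp_mem (C.comp_mem (C.permMat_mem hC h _) (hC _ _ (labelMat_mem_NCfam_of_monotone N
    (Tuple.monotone_sort f) (Tuple.monotone_sort g)))) (C.permMat_mem hC h _)

end TKDual
/-! ### Extracting the basic crossing -/

/-- The restriction of a setoid to the complement of `χ`; the points of `χ` become singletons. -/
def isolate {k : ℕ} (χ : Set (Fin k)) (s : Setoid (Fin k)) : Setoid (Fin k) where
  r x y := x = y ∨ (x ∉ χ ∧ y ∉ χ ∧ s x y)
  iseqv :=
    { refl := fun x => Or.inl rfl
      symm := by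
        rintro x y (h | ⟨hx, hy, h⟩)
        · exact Or.inl h.symm
        · exact Or.inr ⟨hy, hx, s.symm h⟩
      trans := by
        rintro x y z (rfl | ⟨hx, hy, h⟩) (rfl | ⟨hy', hz, h'⟩)
        · exact Or.inl rfl
        · exact Or.inr ⟨hy', hz, h'⟩
        · exact Or.inr ⟨hx, hy, h⟩
        · exact Or.inr ⟨hx, hz, s.trans h h'⟩ }

theorem isolate_mk_eq {k : ℕ} {χ : Set (Fin k)} {s : Setoid (Fin k)} {x y : Fin k} :
    Quotient.mk (isolate χ s) x = Quotient.mk (isolate χ s) y ↔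
      x = y ∨ (x ∉ χ ∧ y ∉ χ ∧ s x y) :=
  Quotient.eq

/-- If all crossings of `s` live in a saturated set `χ`, then the outside of `χ` can be contracted
without crossing the four strings attached to a crossing whose first point is `0`. -/
theorem isolate_labelMat_mem_NCfam (N : ℕ) {k : ℕ} {s : Setoid (Fin k)} {χ : Set (Fin k)}
    (hsat : ∀ x y, s x y → x ∈ χ → y ∈ χ)
    (hcross : ∀ a b c d, a < b → b < c → c < d → s a c → s b d → ¬ s a b → a ∈ χ ∧ b ∈ χ)
    {κ : Fin 4 → Fin k} (hκ : StrictMono κ) (h0 : (κ 0).val = 0) (hχ : ∀ t, κ t ∈ χ)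
    (h02 : s (κ 0) (κ 2)) (h13 : s (κ 1) (κ 3)) :
    labelMat N (Quotient.mk (isolate χ s)) (fun t => Quotient.mk (isolate χ s) (κ t)) ∈
      NCfam N k 4 := by
  have hnc : ∀ {a b c d}, a < b → b < c → c < d → s a c → s b d → a ∉ χ ∨ b ∉ χ → s a b :=
    fun hab hbc hcd hac hbd h => of_not_not fun hn => by
      have := hcross _ _ _ _ hab hbc hcd hac hbd hn
      tauto
  have hκeq : ∀ {x t}, Quotient.mk (isolate χ s) x = Quotient.mk (isolate χ s) (κ t) → x = κ t := by
    intro x t h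
    rcases isolate_mk_eq.1 h with h | h
    · exact h
    · exact absurd (hχ t) h.2.1
  -- no block outside of `χ` encloses one of the four strings
  have hencl : ∀ {u v t}, u < κ t → κ t < v → u ∉ χ → v ∉ χ → ¬ s u v := by
    intro u v t hu hv huχ hvχ huv
    have hout : ∀ {x t}, x ∉ χ → ¬ s x (κ t) := fun hx h => hx (hsat _ _ (s.symm h) (hχ _))
    have hout' : ∀ {x t}, x ∉ χ → ¬ s (κ t) x := fun hx h => hx (hsat _ _ h (hχ _))
    have hne : ∀ {x}, x ∉ χ → ∀ t, x ≠ κ t := by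
      rintro x hx t rfl
      exact hx (hχ t)
    have h0u : κ 0 < u := lt_of_le_of_ne (by rw [Fin.le_def]; omega) (hne huχ 0).symm
    have h01 : κ 0 < κ 1 := hκ (by decide)
    have h12 : κ 1 < κ 2 := hκ (by decide)
    have h23 : κ 2 < κ 3 := hκ (by decide)
    by_cases h2 : u < κ 2
    · by_cases h2' : κ 2 < v
      · exact hout' huχ (hnc h0u h2 h2' h02 huv (Or.inr huχ))
      · have h2v : v < κ 2 := lt_of_le_of_ne (not_lt.1 h2') (hne hvχ 2)
        have hu1 : u < κ 1 := by
          fin_cases t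
          · exact absurd hu (not_lt.2 h0u.le)
          · exact hu
          · exact absurd hv h2'
          · exact absurd (hv.trans h2v) (not_lt.2 h23.le)
        have h1v : κ 1 < v := by
          fin_cases t
          · exact absurd hu (not_lt.2 h0u.le)
          · exact hv
          · exact absurd hv h2'
          · exact absurd (hv.trans h2v) (not_lt.2 h23.le)
        exact hout huχ (hnc hu1 h1v (h2v.trans h23) huv h13 (Or.inl huχ))
    · have h2u : κ 2 < u := lt_of_le_of_ne (not_lt.1 h2) (hne huχ 2).symm
      have ht : t = 3 := by
        fin_cases t
        · exact absurd hu (not_lt.2 h0u.le)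
        · exact absurd (h12.trans h2u) (not_lt.2 hu.le)
        · exact absurd hu (not_lt.2 h2u.le)
        · rfl
      subst ht
      exact hout' huχ (hnc (h12.trans h2u) hu hv h13 huv (Or.inr huχ))
  refine labelMat_mem_NCfam N _ _ fun u₁ u₂ u₃ u₄ => ?_
  refine Fin.addCases (fun a => ?_) (fun a => ?_) u₁ <;>
    refine Fin.addCases (fun b => ?_) (fun b => ?_) u₂ <;>
    refine Fin.addCases (fun c => ?_) (fun c => ?_) u₃ <;>
    refine Fin.addCases (fun d => ?_) (fun d => ?_) u₄ <;>
    intro hab hbc hcd <;>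
    simp only [Fin.append_left, Fin.append_right, Function.comp_apply] <;>
    intro hac hbd
  all_goals
    try (exfalso; simp only [Fin.lt_def, Fin.val_natAdd, Fin.val_castAdd] at hab hbc hcd; omega)
  · replace hab : a < b := hab
    replace hbc : b < c := hbc
    replace hcd : c < d := hcd
    rw [isolate_mk_eq] at *
    rcases hac with rfl | ⟨ha, -, hac⟩
    · exact absurd hbc (not_lt.2 hab.le)
    rcases hbd with rfl | ⟨hb, -, hbd⟩
    · exact absurd hcd (not_lt.2 hbc.le)
    exact Or.inr ⟨ha, hb, hnc hab hbc hcd hac hbd (Or.inl ha)⟩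
  · replace hab : a < b := hab
    replace hbc : b < c := hbc
    obtain rfl := hκeq hbd
    rcases isolate_mk_eq.1 hac with rfl | ⟨ha, hc, hac⟩
    · exact absurd hbc (not_lt.2 hab.le)
    exact absurd hac (hencl hab hbc ha hc)
  · obtain rfl := hκeq hac
    obtain rfl := hκeq hbd
    have h1 : Fin.rev c < Fin.rev d := hκ.lt_iff_lt.1 hab
    rw [Fin.rev_lt_rev] at h1
    simp only [Fin.lt_def, Fin.val_natAdd] at hcd h1
    omega
  · have h1 := Fin.rev_injective (hκ.injective (hκeq hbd))
    subst h1
    exact absurd (hbc.trans hcd) (lt_irrefl _)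
  · have h1 := Fin.rev_injective (hκ.injective (hκeq hbd))
    subst h1
    exact absurd (hbc.trans hcd) (lt_irrefl _)

theorem isolate_labelMat_apply (N : ℕ) {k : ℕ} {s : Setoid (Fin k)} {χ : Set (Fin k)}
    (hsat : ∀ x y, s x y → x ∈ χ → y ∈ χ) {κ : Fin 4 → Fin k} (hκ : Function.Injective κ)
    (hχ : ∀ t, κ t ∈ χ) (y : Fin 4 → Fin N) (u : Fin k → Fin N) :
    labelMat N (Quotient.mk (isolate χ s)) (fun t => Quotient.mk (isolate χ s) (κ t)) y u =
      if u ∘ κ = y then (if ∀ x z, x ∉ χ → s x z → u x = u z then 1 else 0) else 0 := by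
  rw [← ite_and, labelMat]
  simp only [isolate_mk_eq]
  congr 1
  refine propext ⟨fun ⟨h1, h2, _⟩ => ⟨funext fun t => h2 _ t (Or.inl rfl), fun x z hx h =>
    h1 x z (Or.inr ⟨hx, fun hz => hx (hsat _ _ (s.symm h) hz), h⟩)⟩, ?_⟩
  rintro ⟨rfl, h⟩
  refine ⟨?_, ?_, ?_⟩
  · rintro x z (rfl | ⟨hx, -, hxz⟩)
    · rfl
    · exact h x z hx hxz
  · rintro x t (rfl | ⟨-, ht, -⟩)
    · rfl
    · exact absurd (hχ t) ht
  · rintro t t' (h | ⟨ht, -⟩)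
    · rw [hκ h]
    · exact absurd (hχ t) ht

namespace TKDual

variable {N : ℕ} (C : TKDual N)

theorem basicCrossing_mem_of_invariant (hC : ∀ a b, NCfam N a b ≤ C.C a b)
    {w : (Fin 4 → Fin N) → ℂ} (hw : vecMat w ∈ C.C 0 4)
    (hinv : ∀ (σ : Equiv.Perm (Fin N)) y, w (σ ∘ y) = w y)
    (hsupp : ∀ y, w y ≠ 0 → y 0 = y 2 ∧ y 1 = y 3)
    {x z : Fin N} (hxz : x ≠ z) (hne : w ![x, z, x, z] ≠ 0) :
    vecMat (fun y : Fin 4 → Fin N => if y 0 = y 2 ∧ y 1 = y 3 then 1 else 0) ∈ C.C 0 4 := by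
  have hall : (labelMat N Fin.elim0 (fun _ : Fin 4 => (0 : ℕ))) ∈ C.C 0 4 :=
    hC _ _ (labelMat_mem_NCfam_of_monotone N (fun x => x.elim0) monotone_const)
  have key : vecMat (fun y : Fin 4 → Fin N => if y 0 = y 2 ∧ y 1 = y 3 then 1 else 0) =
      (w ![x, z, x, z])⁻¹ • (vecMat w - (w ![x, x, x, x] - w ![x, z, x, z]) •
        labelMat N Fin.elim0 (fun _ : Fin 4 => (0 : ℕ))) := by
    ext y j
    have hlab : labelMat N Fin.elim0 (fun _ : Fin 4 => (0 : ℕ)) y j =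
        if y 0 = y 1 ∧ y 0 = y 2 ∧ y 1 = y 3 then 1 else 0 := by
      rw [labelMat]
      congr 1
      refine propext ⟨fun ⟨_, _, h⟩ => ⟨h _ _ rfl, h _ _ rfl, h _ _ rfl⟩, fun ⟨h1, h2, h3⟩ =>
        ⟨fun x => x.elim0, fun x => x.elim0, fun a b _ => ?_⟩⟩
      fin_cases a <;> fin_cases b <;> simp [h1, ← h2, ← h3]
    simp only [Matrix.smul_apply, Matrix.sub_apply, hlab, vecMat, smul_eq_mul]
    by_cases h : y 0 = y 2 ∧ y 1 = y 3
    · by_cases h1 : y 0 = y 1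
      · obtain ⟨σ, hσ⟩ := exists_perm_comp_eq (f := ![x, x, x, x]) (g := y) fun a b => by
          fin_cases a <;> fin_cases b <;> simp [h1, ← h.1, ← h.2]
        rw [if_pos h, if_pos ⟨h1, h⟩, ← hσ, hinv]
        field_simp
        ring
      · obtain ⟨σ, hσ⟩ := exists_perm_comp_eq (f := ![x, z, x, z]) (g := y) fun a b => by
          fin_cases a <;> fin_cases b <;> simp [h1, ← h.1, ← h.2, hxz, hxz.symm, Ne.symm h1]
        rw [if_pos h, if_neg fun H => h1 H.1, ← hσ, hinv]
        field_simp
        ring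
    · rw [if_neg h, if_neg fun H => h H.2, of_not_not fun H => h (hsupp y H)]
      ring
  rw [key]
  exact Submodule.smul_mem _ _ (Submodule.sub_mem _ hw (Submodule.smul_mem _ _ hall))

/-- The basic crossing is obtained from a combination of partitions which share their crossed
blocks, provided that some common crossing starts at the first point. -/
theorem basicCrossing_mem_of_zero (hC : ∀ a b, NCfam N a b ≤ C.C a b) (hN : 2 ≤ N) {k m : ℕ}
    {s : Fin m → Setoid (Fin k)} {χ : Set (Fin k)}
    (hsat : ∀ i x y, s i x y → x ∈ χ → y ∈ χ)
    (hagree : ∀ i j x y, x ∈ χ → s i x y → s j x y)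
    (hcross : ∀ i a b c d, a < b → b < c → c < d → s i a c → s i b d → ¬ s i a b →
      a ∈ χ ∧ b ∈ χ)
    {κ : Fin 4 → Fin k} (hκ : StrictMono κ) (h0 : (κ 0).val = 0) (hχ : ∀ t, κ t ∈ χ)
    (h02 : ∀ i, s i (κ 0) (κ 2)) (h13 : ∀ i, s i (κ 1) (κ 3)) (h01 : ∀ i, ¬ s i (κ 0) (κ 1))
    {α : Fin m → ℂ} {ξ : (Fin k → Fin N) → ℂ} (hξ : ξ = ∑ i, α i • relVec N (s i)) (hne : ξ ≠ 0)
    (hmem : vecMat ξ ∈ C.C 0 k) :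
    vecMat (fun y : Fin 4 → Fin N => if y 0 = y 2 ∧ y 1 = y 3 then 1 else 0) ∈ C.C 0 4 := by
  let η : (Fin k → Fin N) → ℂ := fun u =>
    ∑ i, α i * if ∀ x z, x ∉ χ → s i x z → u x = u z then 1 else 0
  let Z : (Fin k → Fin N) → Prop := fun u => ∀ i x z, x ∈ χ → s i x z → u x = u z
  let L : Fin m → Mat N k 4 := fun i =>
    labelMat N (Quotient.mk (isolate χ (s i))) (fun t => Quotient.mk (isolate χ (s i)) (κ t))
  have hξη : ∀ u, ξ u = if Z u then η u else 0 := by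
    intro u
    have hrel : ∀ i, relVec N (s i) u =
        if Z u then (if ∀ x z, x ∉ χ → s i x z → u x = u z then 1 else 0) else 0 := by
      intro i
      rw [← ite_and, relVec]
      congr 1
      refine propext ⟨fun h => ⟨fun j x z hx hxz => h x z (hagree j i x z hx hxz),
        fun x z _ => h x z⟩, fun h x z hxz => ?_⟩
      by_cases hx : x ∈ χ
      · exact h.1 i x z hx hxz
      · exact h.2 x z hx hxz
    rw [hξ]
    simp only [Finset.sum_apply, Pi.smul_apply, smul_eq_mul, hrel]
    split_ifs with h
    · rfl
    · simp
  let R : Mat N k 4 := ∑ i, star (α i) • L i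
  have hRNC : R ∈ NCfam N k 4 := Submodule.sum_mem _ fun i _ => Submodule.smul_mem _ _
    (isolate_labelMat_mem_NCfam N (hsat i) (hcross i) hκ h0 hχ (h02 i) (h13 i))
  have hRapply : ∀ y u, R y u = if u ∘ κ = y then star (η u) else 0 := by
    intro y u
    simp only [R, L, Matrix.sum_apply, Matrix.smul_apply,
      isolate_labelMat_apply N (hsat _) hκ.injective hχ, η, smul_eq_mul]
    split_ifs with h
    · simp only [star_sum, star_mul', apply_ite star, star_one, star_zero]
    · simp
  let r : (Fin 4 → Fin N) → ℝ := fun y =>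
    ∑ u : Fin k → Fin N, if u ∘ κ = y ∧ Z u then Complex.normSq (η u) else 0
  have hw : R * vecMat ξ = vecMat fun y => (r y : ℂ) := by
    ext y j
    rw [Matrix.mul_apply]
    simp only [vecMat, r, Complex.ofReal_sum]
    refine Finset.sum_congr rfl fun u _ => ?_
    rw [hRapply, hξη]
    by_cases h1 : u ∘ κ = y <;> by_cases h2 : Z u <;>
      simp [h1, h2, Complex.normSq_eq_conj_mul_self]
  have hξinv : vecMat ξ ∈ invariantSubmodule N 0 k := by
    intro σ i j
    simp only [vecMat, hξ, Finset.sum_apply, Pi.smul_apply, relVec_comp_perm]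
  have hinv : R * vecMat ξ ∈ invariantSubmodule N 0 4 :=
    (invariantDual N).comp_mem (NCfam_le_invariantSubmodule N k 4 hRNC) hξinv
  obtain ⟨u₀, hu₀⟩ := Function.ne_iff.1 hne
  have hη₀ : η u₀ ≠ 0 := by
    intro h
    rw [hξη, h, ite_self] at hu₀
    exact hu₀ rfl
  have : Nonempty (Fin m) := by
    by_contra hemp
    rw [not_nonempty_iff] at hemp
    exact hne (by rw [hξ]; simp)
  obtain ⟨i₀⟩ := this
  let x : Fin N := ⟨0, by omega⟩
  let z : Fin N := ⟨1, by omega⟩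
  have hxz : x ≠ z := by simp [x, z]
  refine C.basicCrossing_mem_of_invariant hC (w := fun y => (r y : ℂ)) (x := x) (z := z) ?_ ?_ ?_
    hxz ?_
  · rw [← hw]
    exact C.comp_mem (hC _ _ hRNC) hmem
  · rw [hw] at hinv
    exact fun σ y => hinv σ y Fin.elim0
  · intro y hy
    obtain ⟨u, -, hu⟩ := Finset.exists_ne_zero_of_sum_ne_zero (Complex.ofReal_ne_zero.1 hy)
    obtain ⟨rfl, hZ⟩ := of_not_not fun h => hu (if_neg h)
    exact ⟨hZ i₀ _ _ (hχ 0) (h02 i₀), hZ i₀ _ _ (hχ 1) (h13 i₀)⟩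
  · rw [Complex.ofReal_ne_zero]
    let u : Fin k → Fin N := fun v => if v ∈ χ then (if s i₀ (κ 0) v then x else z) else u₀ v
    have huη : η u = η u₀ := by
      refine Finset.sum_congr rfl fun i _ => ?_
      congr 2
      refine propext (forall₄_congr fun v v' hv hvv' => ?_)
      have hv' : v' ∉ χ := fun h => hv (hsat i _ _ ((s i).symm hvv') h)
      simp only [u, if_neg hv, if_neg hv']
    have hZ : Z u := by
      intro i v v' hv hvv'
      simp only [u, if_pos hv, if_pos (hsat i _ _ hvv' hv)]
      have h := hagree i i₀ _ _ hv hvv'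
      congr 1
      exact propext ⟨fun h' => (s i₀).trans h' h, fun h' => (s i₀).trans h' ((s i₀).symm h)⟩
    have huκ : u ∘ κ = ![x, z, x, z] := by
      funext t
      simp only [Function.comp_apply, u, if_pos (hχ t)]
      fin_cases t
      · exact if_pos ((s i₀).refl _)
      · exact if_neg (h01 i₀)
      · exact if_pos (h02 i₀)
      · exact if_neg fun h => h01 i₀ ((s i₀).trans h ((s i₀).symm (h13 i₀)))
    refine (Finset.sum_pos' (fun v _ => ?_) ⟨u, Finset.mem_univ _, ?_⟩).ne'
    · split_ifs
      · exact Complex.normSq_nonneg _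
      · exact le_rfl
    · rw [if_pos ⟨huκ, hZ⟩, huη]
      exact Complex.normSq_pos.2 hη₀

/-- The basic crossing is obtained from a combination of partitions which share their crossed
blocks. -/
theorem basicCrossing_mem (hC : ∀ a b, NCfam N a b ≤ C.C a b) (hN : 2 ≤ N) {k m : ℕ}
    {s : Fin m → Setoid (Fin (k + 1))} {χ : Set (Fin (k + 1))}
    (hsat : ∀ i x y, s i x y → x ∈ χ → y ∈ χ)
    (hagree : ∀ i j x y, x ∈ χ → s i x y → s j x y)
    (hcross : ∀ i a b c d, a < b → b < c → c < d → s i a c → s i b d → ¬ s i a b →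
      a ∈ χ ∧ b ∈ χ)
    {κ : Fin 4 → Fin (k + 1)} (hκ : StrictMono κ) (hχ : ∀ t, κ t ∈ χ)
    (h02 : ∀ i, s i (κ 0) (κ 2)) (h13 : ∀ i, s i (κ 1) (κ 3)) (h01 : ∀ i, ¬ s i (κ 0) (κ 1))
    {α : Fin m → ℂ} {ξ : (Fin (k + 1) → Fin N) → ℂ} (hξ : ξ = ∑ i, α i • relVec N (s i))
    (hne : ξ ≠ 0) (hmem : vecMat ξ ∈ C.C 0 (k + 1)) :
    vecMat (fun y : Fin 4 → Fin N => if y 0 = y 2 ∧ y 1 = y 3 then 1 else 0) ∈ C.C 0 4 := by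
  induction hn : (κ 0).val generalizing s χ κ ξ with
  | zero =>
    exact C.basicCrossing_mem_of_zero hC hN hsat hagree hcross hκ hn hχ h02 h13 h01 hξ hne hmem
  | succ n ih =>
    let π : Equiv.Perm (Fin (k + 1)) := finRotate (k + 1)
    have hπlast : π (Fin.last k) = 0 := finRotate_last
    have hπlt : ∀ {a : Fin (k + 1)}, a ≠ Fin.last k → (π a).val = a.val + 1 := fun h =>
      coe_finRotate_of_ne_last h
    have hsymm : ∀ t, (π.symm (κ t)).val + 1 = (κ t).val := fun t => by
      have h0t : (κ 0).val ≤ (κ t).val := hκ.monotone (Fin.zero_le t)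
      have h := hπlt (a := π.symm (κ t)) fun h => by
        rw [Equiv.symm_apply_eq, hπlast] at h
        rw [h] at h0t
        simp only [Fin.val_zero] at h0t
        omega
      rw [Equiv.apply_symm_apply] at h
      exact h.symm
    have hrot : ∀ i : Fin (k + 1) → Fin N,
        (Fin.cons (i (Fin.last k)) (Fin.init i) : Fin (k + 1) → Fin N) = i ∘ π.symm := by
      intro i
      funext x
      obtain ⟨x, rfl⟩ := π.surjective x
      rw [Function.comp_apply, Equiv.symm_apply_apply]
      rcases Fin.eq_castSucc_or_eq_last x with ⟨a, rfl⟩ | rfl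
      · have : π a.castSucc = a.succ := Fin.ext (by
          rw [hπlt (Fin.castSucc_lt_last a).ne, Fin.val_castSucc, Fin.val_succ])
        rw [this, Fin.cons_succ]
        rfl
      · rw [hπlast, Fin.cons_zero]
    refine ih (s := fun i => (s i).comap π) (χ := π ⁻¹' χ) (κ := π.symm ∘ κ)
      (ξ := fun i => ξ (Fin.cons (i (Fin.last k)) (Fin.init i)))
      (fun i x y => hsat i _ _) (fun i j x y => hagree i j _ _) ?_ ?_ ?_ ?_ ?_ ?_ ?_ ?_
      (C.rotate_mem hC hmem) ?_
    · intro i a b c d hab hbc hcd hac hbd hn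
      have hca : c ≠ Fin.last k := (hcd.trans_le (Fin.le_last d)).ne
      have hba : b ≠ Fin.last k := (hbc.trans_le (Fin.le_last c)).ne
      have haa : a ≠ Fin.last k := (hab.trans_le (Fin.le_last b)).ne
      have hab' : π a < π b := by rw [Fin.lt_def, hπlt haa, hπlt hba]; exact Nat.succ_lt_succ hab
      have hbc' : π b < π c := by rw [Fin.lt_def, hπlt hba, hπlt hca]; exact Nat.succ_lt_succ hbc
      by_cases hd : d = Fin.last k
      · have h := hcross i (π d) (π a) (π b) (π c)
          (by rw [hd, hπlast, Fin.lt_def, hπlt haa]; exact Nat.succ_pos _) hab' hbc'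
          ((s i).symm hbd) hac fun h => hn ((s i).symm ((s i).trans hbd h))
        exact ⟨h.2, hsat i _ _ ((s i).symm hbd) h.1⟩
      · exact hcross i _ _ _ _ hab' hbc'
          (by rw [Fin.lt_def, hπlt hca, hπlt hd]; exact Nat.succ_lt_succ hcd) hac hbd hn
    · intro t t' htt'
      have h1 := hsymm t
      have h2 := hsymm t'
      have h3 : (κ t).val < (κ t').val := hκ htt'
      simp only [Function.comp_apply, Fin.lt_def]
      omega
    · intro t
      simpa using hχ t
    · intro i
      simpa [Setoid.comap_rel] using h02 i
    · intro i
      simpa [Setoid.comap_rel] using h13 i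
    · intro i
      simpa [Setoid.comap_rel] using h01 i
    · funext u
      simp only [hrot, hξ, Finset.sum_apply, Pi.smul_apply]
      refine Finset.sum_congr rfl fun i _ => ?_
      congr 1
      simp only [relVec, Setoid.comap_rel]
      congr 1
      refine propext ⟨fun h x y hxy => by simpa using h _ _ hxy, fun h x y hxy => ?_⟩
      exact h _ _ (by simpa using hxy)
    · obtain ⟨u, hu⟩ := Function.ne_iff.1 hne
      refine Function.ne_iff.2 ⟨u ∘ π, ?_⟩
      rw [hrot, Function.comp_assoc, Equiv.self_comp_symm, Function.comp_id]
      exact hu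
    · have := hsymm 0
      simp only [Function.comp_apply]
      omega

end TKDual

/-! ### Partitions with the same crossings -/

/-- The points `a < b < c < d` form a crossing of `s`. -/
def CrossesAt {k : ℕ} (s : Setoid (Fin k)) (a b c d : Fin k) : Prop :=
  a < b ∧ b < c ∧ c < d ∧ s a c ∧ s b d ∧ ¬ s a b

theorem eq_of_quadruple_eq {k : ℕ} {a b c d a' b' c' d' : Fin k} (hab : a < b) (hbc : b < c)
    (hcd : c < d) (hab' : a' < b') (hbc' : b' < c') (hcd' : c' < d')
    (h : ({a, b, c, d} : Finset (Fin k)) = {a', b', c', d'}) :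
    a = a' ∧ b = b' ∧ c = c' ∧ d = d' := by
  simp only [Finset.ext_iff, Finset.mem_insert, Finset.mem_singleton] at h
  have ha := (h a).1 (by simp)
  have hb := (h b).1 (by simp)
  have hc := (h c).1 (by simp)
  have hd := (h d).1 (by simp)
  have ha' := (h a').2 (by simp)
  have hb' := (h b').2 (by simp)
  have hc' := (h c').2 (by simp)
  have hd' := (h d').2 (by simp)
  have e1 : a = a' := by omega
  have e2 : b = b' := by omega
  have e3 : c = c' := by omega
  have e4 : d = d' := by omega
  exact ⟨e1, e2, e3, e4⟩

theorem crossesAt_of_cr_eq {k : ℕ} {p q : Finpartition (Finset.univ : Finset (Fin k))}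
    (h : cr p = cr q) {a b c d : Fin k} (hp : CrossesAt (partSetoid p) a b c d) :
    CrossesAt (partSetoid q) a b c d := by
  obtain ⟨hab, hbc, hcd, hac, hbd, hn⟩ := hp
  have hmem : ({a, b, c, d} : Finset (Fin k)) ∈ cr p :=
    ⟨a, b, c, d, hab, hbc, hcd, rfl, hac, hbd, hn⟩
  rw [h] at hmem
  obtain ⟨a', b', c', d', hab', hbc', hcd', he, hac', hbd', hn'⟩ := hmem
  obtain ⟨rfl, rfl, rfl, rfl⟩ := eq_of_quadruple_eq hab hbc hcd hab' hbc' hcd' he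
  exact ⟨hab, hbc, hcd, hac', hbd', hn'⟩

/-- If every crossing of `s` is one of `t`, then a block of `s` with a crossing consists of crossing
points and is contained in a block of `t`. -/
theorem CrossesAt.rel_and_exists {k : ℕ} {s t : Setoid (Fin k)}
    (hst : ∀ {a b c d}, CrossesAt s a b c d → CrossesAt t a b c d) {a b c d x y : Fin k}
    (h : CrossesAt s a b c d) (hx : x = a ∨ x = b ∨ x = c ∨ x = d) (hxy : s x y) :
    t x y ∧ ∃ a b c d, CrossesAt s a b c d ∧ (y = a ∨ y = b ∨ y = c ∨ y = d) := by
  have ht := hst h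
  obtain ⟨hab, hbc, hcd, hac, hbd, hn⟩ := h
  obtain ⟨-, -, -, hac', hbd', -⟩ := ht
  have first : s a y → t a y ∧ ∃ a b c d, CrossesAt s a b c d ∧
      (y = a ∨ y = b ∨ y = c ∨ y = d) := by
    intro hay
    have hyb : y ≠ b := fun h => hn (h ▸ hay)
    have hyd : y ≠ d := fun h => hn (s.trans hay (h ▸ s.symm hbd))
    have hcy : s c y := s.trans (s.symm hac) hay
    rcases lt_or_gt_of_ne hyb with h1 | h1
    · have h : CrossesAt s y b c d :=
        ⟨h1, hbc, hcd, s.symm hcy, hbd, fun h => hn (s.trans hay h)⟩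
      exact ⟨t.trans hac' (t.symm (hst h).2.2.2.1), y, b, c, d, h, by simp⟩
    rcases lt_or_gt_of_ne hyd with h2 | h2
    · have h : CrossesAt s a b y d := ⟨hab, h1, h2, hay, hbd, hn⟩
      exact ⟨(hst h).2.2.2.1, a, b, y, d, h, by simp⟩
    · have h : CrossesAt s b c d y :=
        ⟨hbc, hcd, h2, hbd, hcy, fun h => hn (s.symm (s.trans h (s.symm hac)))⟩
      exact ⟨t.trans hac' (hst h).2.2.2.2.1, b, c, d, y, h, by simp⟩
  have second : s b y → t b y ∧ ∃ a b c d, CrossesAt s a b c d ∧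
      (y = a ∨ y = b ∨ y = c ∨ y = d) := by
    intro hby
    have hya : y ≠ a := fun h => hn (h ▸ s.symm hby)
    have hyc : y ≠ c := fun h => hn (s.trans hac (h ▸ s.symm hby))
    rcases lt_or_gt_of_ne hya with h1 | h1
    · have h : CrossesAt s y a b c :=
        ⟨h1, hab, hbc, s.symm hby, hac, fun h => hn (s.symm (s.trans hby h))⟩
      exact ⟨t.symm (hst h).2.2.2.1, y, a, b, c, h, by simp⟩
    rcases lt_or_gt_of_ne hyc with h2 | h2
    · have h : CrossesAt s a y c d :=
        ⟨h1, h2, hcd, hac, s.trans (s.symm hby) hbd, fun h => hn (s.trans h (s.symm hby))⟩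
      exact ⟨t.trans hbd' (t.symm (hst h).2.2.2.2.1), a, y, c, d, h, by simp⟩
    · have h : CrossesAt s a b c y := ⟨hab, hbc, h2, hac, hby, hn⟩
      exact ⟨(hst h).2.2.2.2.1, a, b, c, y, h, by simp⟩
  rcases hx with rfl | rfl | rfl | rfl
  · exact first hxy
  · exact second hxy
  · exact (first (s.trans hac hxy)).imp_left (t.trans (t.symm hac'))
  · exact (second (s.trans hbd hxy)).imp_left (t.trans (t.symm hbd'))

/-- for `N ≥ 4`, distinct partitions `p₁, …, p_m` of `[k]`, each with at
least one crossing and all with the same set of crossings, and nonzero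
`ξ = ∑ α_i ξ_{p_i}`, the Tannaka–Krein dual `⟨NC, ξ⟩` equals `P`. -/
theorem stmt14 {N k m : ℕ} (hN : 4 ≤ N)
    (p : Fin m → Finpartition (Finset.univ : Finset (Fin k)))
    (hinj : Function.Injective p)
    (hcross : ∀ i, (cr (p i)).Nonempty)
    (heq : ∀ i j, cr (p i) = cr (p j))
    (α : Fin m → ℂ)
    (ξ : (Fin k → Fin N) → ℂ) (hξ : ξ = ∑ i, α i • xi N (p i)) (hne : ξ ≠ 0) :
    ∀ k' ℓ', genNCxi N ξ k' ℓ' = Pfam N k' ℓ' := by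
  intro k' ℓ'
  refine le_antisymm ?_ (le_iInf fun C => le_iInf fun hC => le_iInf fun hmem => ?_)
  · refine le_trans ?_ (invariantSubmodule_le_Pfam N k' ℓ')
    refine iInf_le_of_le (invariantDual N) (iInf_le_of_le (NCfam_le_invariantSubmodule N)
      (iInf_le_of_le (fun σ i j => ?_) le_rfl))
    simp only [vecMat, hξ, xi_eq_relVec, Finset.sum_apply, Pi.smul_apply, relVec_comp_perm]
  · have : Nonempty (Fin m) := by
      by_contra hemp
      rw [not_nonempty_iff] at hemp
      exact hne (by rw [hξ]; simp)
    obtain ⟨i₀⟩ := this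
    have htrans : ∀ i j {a b c d}, CrossesAt (partSetoid (p i)) a b c d →
        CrossesAt (partSetoid (p j)) a b c d := fun i j => crossesAt_of_cr_eq (heq i j)
    obtain ⟨_, a, b, c, d, hab, hbc, hcd, -, hac, hbd, hn⟩ := hcross i₀
    have habcd : CrossesAt (partSetoid (p i₀)) a b c d := ⟨hab, hbc, hcd, hac, hbd, hn⟩
    obtain ⟨k, rfl⟩ : ∃ n, k = n + 1 := ⟨k - 1, by have := a.isLt; omega⟩
    refine C.Pfam_le hC (C.swapMat_mem hC (C.basicCrossing_mem hC (by omega)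
      (s := fun i => partSetoid (p i))
      (χ := {x | ∃ a b c d, CrossesAt (partSetoid (p i₀)) a b c d ∧
        (x = a ∨ x = b ∨ x = c ∨ x = d)}) (κ := ![a, b, c, d])
      ?_ ?_ ?_ ?_ ?_ ?_ ?_ ?_ hξ hne hmem)) k' ℓ'
    · rintro i x y hxy ⟨a, b, c, d, h, hx⟩
      obtain ⟨-, a', b', c', d', h', hy⟩ := (htrans i₀ i h).rel_and_exists id hx hxy
      exact ⟨a', b', c', d', htrans i i₀ h', hy⟩
    · rintro i j x y ⟨a, b, c, d, h, hx⟩ hxy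
      exact ((htrans i₀ i h).rel_and_exists (htrans i j) hx hxy).1
    · intro i a b c d hab hbc hcd hac hbd hn
      have h := htrans i i₀ ⟨hab, hbc, hcd, hac, hbd, hn⟩
      exact ⟨⟨a, b, c, d, h, by simp⟩, ⟨a, b, c, d, h, by simp⟩⟩
    · rw [Fin.strictMono_iff_lt_succ]
      intro t
      fin_cases t
      · exact hab
      · exact hbc
      · exact hcd
    · intro t
      refine ⟨a, b, c, d, habcd, ?_⟩
      fin_cases t <;> simp
    · exact fun i => (htrans i₀ i habcd).2.2.2.1
    · exact fun i => (htrans i₀ i habcd).2.2.2.2.1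
    · exact fun i => (htrans i₀ i habcd).2.2.2.2.2
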